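/- Let M = M^0(S; F(I), G(Lambda); P) be a Rees matrix semigroup with zero over a semigroupoid S. Suppose M is an automatic semigroup, and the set of non-identity arrows of S is strongly right-ideal-generated by a row cross-section of P. Then S is automatic. -/

import Mathlib

/- Common framework: graphs, path languages, synchronous regularity,
   semigroupoids, automatic structures, and Rees matrix constructions. -/

namespace AutoRees

/-- Raw data of a semigroupoid: source and target maps on arrows together with a
totalised multiplication (whose values are only meaningful on composable pairs). -/
structure PreSgpd (O A : Type) where
  src : A → O
  tgt : A → O
  mul : A → A → A

/-- A semigroupoid: the multiplication respects sources and targets and is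
associative, on composable pairs. -/
structure Sgpd (O A : Type) extends PreSgpd O A where
  src_mul : ∀ e f, tgt e = src f → src (mul e f) = src e
  tgt_mul : ∀ e f, tgt e = src f → tgt (mul e f) = tgt f
  mul_assoc' : ∀ e f g, tgt e = src f → tgt f = src g →
    mul (mul e f) g = mul e (mul f g)

/-- Evaluate a nonempty word of edge labels as a product in the semigroupoid
(`none` on the empty word). -/
def evalPath? {O A E : Type} (S : PreSgpd O A) (lab : E → A) : List E → Option A
  | [] => none
  | e :: l => some ((l.map lab).foldl S.mul (lab e))

/-- The consecutive-compatibility condition making a list of edges a path. -/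
def IsPathChain {V E : Type} (esrc etgt : E → V) (l : List E) : Prop :=
  List.Chain' (fun e f => etgt e = esrc f) l

/-- The target of a non-empty path. -/
def pathTgt? {V E : Type} (etgt : E → V) (l : List E) : Option V :=
  l.getLast?.map etgt

/-- The source of a non-empty path. -/
def pathSrc? {V E : Type} (esrc : E → V) (l : List E) : Option V :=
  l.head?.map esrc

/-- A set of words is regular if it is a regular language in the usual sense. -/
def IsRegularSet {α : Type} (L : Set (List α)) : Prop :=
  Language.IsRegular (show Language α from L)

/-- The padding symbol used to pad a pair of paths, at the target of `l`
(the letters of the padded alphabet `X^$` are `Sum.inl` (a genuine edge) or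
`Sum.inr (some v)` (the padding edge at vertex `v`)). -/
def padSym {V E : Type} (etgt : E → V) (l : List E) : E ⊕ Option V :=
  Sum.inr (l.getLast?.map etgt)

/-- The padded convolution `(a, b) δ_X` of a pair of paths. -/
def deltaPair {V E : Type} (etgt : E → V) (a b : List E) :
    List ((E ⊕ Option V) × (E ⊕ Option V)) :=
  (a.map Sum.inl).zip (b.map Sum.inl) ++
    (if a.length ≤ b.length
      then (b.drop a.length).map (fun e => (padSym etgt a, Sum.inl e))
      else (a.drop b.length).map (fun e => (Sum.inl e, padSym etgt b)))

/-- A binary relation on paths is synchronously regular if its image under the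
padding map is a regular language over the padded product alphabet. -/
def SyncRegular {V E : Type} (etgt : E → V) (R : Set (List E × List E)) : Prop :=
  IsRegularSet { w | ∃ p ∈ R, w = deltaPair etgt p.1 p.2 }

/-- A choice of representatives `(X, K, ρ)` for a semigroupoid `S`: a graph `X`
with vertex set `S^0` (edge set `E`, source `esrc`, target `etgt`), a semigroupoid
morphism `ρ : X^+ → S` (induced by the edge-labelling `lab`), and a language `K`
of non-empty paths with `K ρ = S^1`. -/
structure ChoiceOfReps {O A : Type} (S : PreSgpd O A) (E : Type) where
  esrc : E → O
  etgt : E → O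
  lab : E → A
  lab_src : ∀ e, S.src (lab e) = esrc e
  lab_tgt : ∀ e, S.tgt (lab e) = etgt e
  K : Set (List E)
  K_path : ∀ l ∈ K, l ≠ [] ∧ IsPathChain esrc etgt l
  K_onto : ∀ a : A, ∃ l ∈ K, evalPath? S lab l = some a

variable {O A E : Type} {S : PreSgpd O A}

/-- The relation `K_=` = {(u,v) ∈ K × K : u ρ = v ρ}. -/
def relEq (C : ChoiceOfReps S E) : Set (List E × List E) :=
  { p | p.1 ∈ C.K ∧ p.2 ∈ C.K ∧ evalPath? S C.lab p.1 = evalPath? S C.lab p.2 }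

/-- The relation `K_a` for an edge `a` of `X`. -/
def relEdge (C : ChoiceOfReps S E) (a : E) : Set (List E × List E) :=
  { p | p.1 ∈ C.K ∧ p.2 ∈ C.K ∧ pathTgt? C.etgt p.1 = some (C.esrc a) ∧
        evalPath? S C.lab (p.1 ++ [a]) = evalPath? S C.lab p.2 }

/-- The relation `K_a` for a vertex `a` of `X` (regarded as the empty path at `a`). -/
def relVertex (C : ChoiceOfReps S E) (v : O) : Set (List E × List E) :=
  { p | p.1 ∈ C.K ∧ p.2 ∈ C.K ∧ pathTgt? C.etgt p.1 = some v ∧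
        evalPath? S C.lab p.1 = evalPath? S C.lab p.2 }

/-- An automatic structure: a finitely generated choice of representatives with
`K` regular such that `K_a` is synchronously regular for every edge and vertex. -/
def IsAutomaticStructure (C : ChoiceOfReps S E) : Prop :=
  Finite E ∧ IsRegularSet C.K ∧
    (∀ a : E, SyncRegular C.etgt (relEdge C a)) ∧
    (∀ v : O, SyncRegular C.etgt (relVertex C v))

/-- The set of non-empty prefixes of words in `K`. -/
def prefs {E : Type} (K : Set (List E)) : Set (List E) :=
  { p | p ≠ [] ∧ ∃ l ∈ K, p <+: l }

/-- The relation `K'_=` = {(u,v) ∈ K × Pref(K) : u ρ = v ρ}. -/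
def relPrefEq (C : ChoiceOfReps S E) : Set (List E × List E) :=
  { p | p.1 ∈ C.K ∧ p.2 ∈ prefs C.K ∧ evalPath? S C.lab p.1 = evalPath? S C.lab p.2 }

/-- A prefix-automatic structure. -/
def IsPrefixAutomaticStructure (C : ChoiceOfReps S E) : Prop :=
  IsAutomaticStructure C ∧ SyncRegular C.etgt (relPrefEq C)

/-- A cross-section: `ρ` restricted to `K` is injective. -/
def IsCrossSection (C : ChoiceOfReps S E) : Prop :=
  ∀ u ∈ C.K, ∀ v ∈ C.K, evalPath? S C.lab u = evalPath? S C.lab v → u = v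

/-- `K` is closed under taking non-empty prefixes. -/
def IsPrefixClosed (C : ChoiceOfReps S E) : Prop :=
  ∀ l ∈ C.K, ∀ p : List E, p ≠ [] → p <+: l → p ∈ C.K

/-- A semigroupoid (or semigroup, in the one-object case) is automatic if it
admits an automatic structure. -/
def IsAutomatic (S : PreSgpd O A) : Prop :=
  ∃ (E : Type) (C : ChoiceOfReps S E), IsAutomaticStructure C

/-- Prefix-automaticity. -/
def IsPrefixAutomatic (S : PreSgpd O A) : Prop :=
  ∃ (E : Type) (C : ChoiceOfReps S E), IsPrefixAutomaticStructure C

/-- Finite generation: every arrow is a (composable) product of arrows from some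
fixed finite set. -/
def IsFG (S : PreSgpd O A) : Prop :=
  ∃ T : Set A, T.Finite ∧ ∀ a : A, ∃ l : List A, l ≠ [] ∧ (∀ x ∈ l, x ∈ T) ∧
    IsPathChain S.src S.tgt l ∧ evalPath? S id l = some a

/-- An arrow is an identity if it acts as an identity on all composable products. -/
def IsIdentity (S : PreSgpd O A) (e : A) : Prop :=
  (∀ x, S.tgt e = S.src x → S.mul e x = x) ∧ (∀ y, S.tgt y = S.src e → S.mul y e = y)

/-- A small category is a semigroupoid with an identity arrow at every object. -/
def IsSmallCategory (S : PreSgpd O A) : Prop :=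
  ∀ v : O, ∃ e : A, S.src e = v ∧ S.tgt e = v ∧ IsIdentity S e

/-- No object is isolated. -/
def IsolationFree (S : PreSgpd O A) : Prop :=
  ∀ v : O, ∃ a : A, S.src a = v ∨ S.tgt a = v

namespace Rees

variable {O A I Λ : Type}

/-- A triple `(i, x, λ)` is valid if `i F = x α` and `x ω = λ G`. -/
def Valid (S : Sgpd O A) (F : I → O) (G : Λ → O) (t : I × A × Λ) : Prop :=
  F t.1 = S.src t.2.1 ∧ S.tgt t.2.1 = G t.2.2

/-- The set of valid Rees triples. -/
def Triples (S : Sgpd O A) (F : I → O) (G : Λ → O) : Type :=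
  { t : I × A × Λ // Valid S F G t }

theorem prod_valid (S : Sgpd O A) {F : I → O} {G : Λ → O}
    {i : I} {x : A} {lam : Λ} {j : I} {y : A} {mu : Λ} {p : A}
    (hx : Valid S F G (i, x, lam)) (hy : Valid S F G (j, y, mu))
    (hps : S.src p = G lam) (hpt : S.tgt p = F j) :
    Valid S F G (i, S.mul (S.mul x p) y, mu) := by
  obtain ⟨hx1, hx2⟩ := hx
  obtain ⟨hy1, hy2⟩ := hy
  have h1 : S.tgt x = S.src p := by rw [hps]; exact hx2
  have h2 : S.tgt p = S.src y := by rw [hpt]; exact hy1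
  have h3 : S.tgt (S.mul x p) = S.src y := by rw [S.tgt_mul x p h1]; exact h2
  constructor
  · show F i = S.src (S.mul (S.mul x p) y)
    rw [S.src_mul _ y h3, S.src_mul x p h1]; exact hx1
  · show S.tgt (S.mul (S.mul x p) y) = G mu
    rw [S.tgt_mul _ y h3]; exact hy2

/-- Data for a Rees matrix construction with zero over a semigroupoid `S`:
indexing functions `F`, `G` surjective onto the sets of sources and of targets
respectively, and a sandwich matrix `P` with entries in `S^1 ∪ {0}`
(`none` representing `0`) compatible with `F` and `G`. -/
structure Data0 (S : Sgpd O A) (I Λ : Type) where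
  F : I → O
  G : Λ → O
  P : Λ → I → Option A
  F_into : ∀ i, ∃ a : A, S.src a = F i
  F_onto : ∀ a : A, ∃ i, F i = S.src a
  G_into : ∀ lam, ∃ a : A, S.tgt a = G lam
  G_onto : ∀ a : A, ∃ lam, G lam = S.tgt a
  P_src : ∀ lam i p, P lam i = some p → S.src p = G lam
  P_tgt : ∀ lam i p, P lam i = some p → S.tgt p = F i

/-- Underlying set of the Rees matrix semigroup with zero (`none` is the zero). -/
def Carrier0 (S : Sgpd O A) (R : Data0 S I Λ) : Type :=
  Option (Triples S R.F R.G)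

/-- Multiplication of the Rees matrix semigroup with zero. -/
def mul0 (S : Sgpd O A) (R : Data0 S I Λ) :
    Carrier0 S R → Carrier0 S R → Carrier0 S R
  | some ⟨(i, x, lam), hx⟩, some ⟨(j, y, mu), hy⟩ =>
    match hp : R.P lam j with
    | some p => some ⟨(i, S.mul (S.mul x p) y, mu),
        prod_valid S hx hy (R.P_src lam j p hp) (R.P_tgt lam j p hp)⟩
    | none => none
  | none, _ => none
  | _, none => none

/-- The Rees matrix semigroup with zero `M^0(S; F(I), G(Λ); P)`, as a
one-object semigroupoid (i.e. a semigroup). -/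
def pre0 (S : Sgpd O A) (R : Data0 S I Λ) : PreSgpd Unit (Carrier0 S R) where
  src _ := ()
  tgt _ := ()
  mul := mul0 S R

/-- Data for a Rees matrix construction without zero (no zero entries in `P`). -/
structure Data (S : Sgpd O A) (I Λ : Type) where
  F : I → O
  G : Λ → O
  P : Λ → I → A
  F_into : ∀ i, ∃ a : A, S.src a = F i
  F_onto : ∀ a : A, ∃ i, F i = S.src a
  G_into : ∀ lam, ∃ a : A, S.tgt a = G lam
  G_onto : ∀ a : A, ∃ lam, G lam = S.tgt a
  P_src : ∀ lam i, S.src (P lam i) = G lam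
  P_tgt : ∀ lam i, S.tgt (P lam i) = F i

/-- Underlying set of the Rees matrix semigroup without zero. -/
def Carrier (S : Sgpd O A) (R : Data S I Λ) : Type :=
  Triples S R.F R.G

/-- Multiplication of the Rees matrix semigroup without zero. -/
def mul (S : Sgpd O A) (R : Data S I Λ) :
    Carrier S R → Carrier S R → Carrier S R
  | ⟨(i, x, lam), hx⟩, ⟨(j, y, mu), hy⟩ =>
    ⟨(i, S.mul (S.mul x (R.P lam j)) y, mu),
      prod_valid S hx hy (R.P_src lam j) (R.P_tgt lam j)⟩

/-- The Rees matrix semigroup without zero `M(S; F(I), G(Λ); P)`, as a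
one-object semigroupoid (i.e. a semigroup). -/
def pre (S : Sgpd O A) (R : Data S I Λ) : PreSgpd Unit (Carrier S R) where
  src _ := ()
  tgt _ := ()
  mul := mul S R

/-- The set `S P' S` of arrows of the form `s p t` with `p` a non-zero entry of `P`. -/
def SPS0 (S : Sgpd O A) (R : Data0 S I Λ) : Set A :=
  { a | ∃ s p t lam i, R.P lam i = some p ∧ S.tgt s = S.src p ∧ S.tgt p = S.src t ∧
        a = S.mul (S.mul s p) t }

/-- The set `S P S` for a matrix without zero entries. -/
def SPS (S : Sgpd O A) (R : Data S I Λ) : Set A :=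
  { a | ∃ s t lam i, S.tgt s = S.src (R.P lam i) ∧ S.tgt (R.P lam i) = S.src t ∧
        a = S.mul (S.mul s (R.P lam i)) t }

/-- The set of targets of arrows of `S` (the codomain of `G`). -/
def tgtSet (S : Sgpd O A) : Set O := { v | ∃ a : A, S.tgt a = v }

/-- `T` is strongly right-ideal-generated by a row cross-section of `P`. -/
def StronglyRIG0 (S : Sgpd O A) (R : Data0 S I Λ) (T : Set A) : Prop :=
  ∃ Λ' : Set Λ, Set.BijOn R.G Λ' (tgtSet S) ∧
    ∀ t ∈ T, ∃ lam ∈ Λ', ∃ i p s, R.P lam i = some p ∧ S.tgt p = S.src s ∧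
      t = S.mul p s

/-- `T` is weakly right-ideal-generated by a row cross-section of `P`. -/
def WeaklyRIG0 (S : Sgpd O A) (R : Data0 S I Λ) (T : Set A) : Prop :=
  ∃ Λ' : Set Λ, Set.BijOn R.G Λ' (tgtSet S) ∧
    ∀ t ∈ T, ∃ lam ∈ Λ', ∃ i p, R.P lam i = some p ∧
      (t = p ∨ ∃ s, S.tgt p = S.src s ∧ t = S.mul p s)

/-- Weak right-ideal generation, for a matrix without zero entries. -/
def WeaklyRIG (S : Sgpd O A) (R : Data S I Λ) (T : Set A) : Prop :=
  ∃ Λ' : Set Λ, Set.BijOn R.G Λ' (tgtSet S) ∧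
    ∀ t ∈ T, ∃ lam ∈ Λ', ∃ i,
      (t = R.P lam i ∨ ∃ s, S.tgt (R.P lam i) = S.src s ∧ t = S.mul (R.P lam i) s)

end Rees

/-! ### Regular languages via finite families closed under derivatives -/

theorem reg_iff {α : Type} (L : Set (List α)) :
    IsRegularSet L ↔ ∃ Q : Set (Set (List α)), Q.Finite ∧ L ∈ Q ∧
      ∀ q ∈ Q, ∀ a, {x | a :: x ∈ q} ∈ Q := by
  constructor
  · rintro ⟨σ, hσ, M, hM⟩
    refine ⟨Set.range (fun s => (show Set (List α) from M.acceptsFrom s)),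
      Set.finite_range _, ⟨M.start, hM⟩, ?_⟩
    rintro _ ⟨s, rfl⟩ a
    refine ⟨M.step s a, ?_⟩
    ext x
    rfl
  · rintro ⟨Q, hf, hL, hc⟩
    have : Finite Q := hf
    have := Fintype.ofFinite Q
    let M : DFA α Q :=
      { step := fun q a => ⟨{x | a :: x ∈ q.1}, hc q.1 q.2 a⟩
        start := ⟨L, hL⟩
        accept := {q | [] ∈ q.1} }
    have key : ∀ (w : List α) (q : Q), M.evalFrom q w ∈ M.accept ↔ w ∈ q.1 := by
      intro w
      induction w with
      | nil => intro q; rfl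
      | cons a w ih => intro q; exact ih _
    refine ⟨Q, inferInstance, M, ?_⟩
    ext w
    exact key w _

theorem reg_inter {α : Type} {L L' : Set (List α)} (h : IsRegularSet L) (h' : IsRegularSet L') :
    IsRegularSet (L ∩ L') :=
  Language.IsRegular.inf h h'

theorem reg_comap {α β : Type} {L : Set (List β)} (h : IsRegularSet L) (f : α → Option β) :
    IsRegularSet {w : List α | w.filterMap f ∈ L} := by
  obtain ⟨Q, hf, hL, hc⟩ := (reg_iff L).1 h
  refine (reg_iff _).2 ⟨(fun q => {w : List α | w.filterMap f ∈ q}) '' Q, hf.image _, ⟨L, hL, rfl⟩, ?_⟩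
  rintro _ ⟨q, hq, rfl⟩ a
  rcases hfa : f a with _ | b
  · refine ⟨q, hq, ?_⟩
    ext x; simp [hfa]
  · refine ⟨_, hc q hq b, ?_⟩
    ext x; simp [hfa]

theorem reg_invariant {α σ : Type} [Finite σ] (q : List α → σ) (st : σ → α → σ)
    (hq : ∀ w a, q (w ++ [a]) = st (q w) a) (B : Set σ) :
    IsRegularSet {w | q w ∈ B} := by
  have := Fintype.ofFinite σ
  refine ⟨σ, inferInstance, ⟨st, q [], B⟩, ?_⟩
  ext w
  have : (DFA.mk st (q []) B).eval w = q w := by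
    induction w using List.reverseRecOn with
    | nil => rfl
    | append_singleton w a ih => rw [DFA.eval_append_singleton, ih, hq]
  show (DFA.mk st (q []) B).eval w ∈ B ↔ _
  rw [this]; rfl

/-- Run of a Mealy machine. -/
def mealy {σ α β : Type} (st : σ → α → σ) (out : σ → α → β) : σ → List α → List β
  | _, [] => []
  | s, a :: l => out s a :: mealy st out (st s a) l

theorem reg_mealy {σ α β : Type} [Finite σ] (st : σ → α → σ) (out : σ → α → β) (s : σ)
    {L : Set (List α)} (h : IsRegularSet L) :
    IsRegularSet {w | ∃ l ∈ L, w = mealy st out s l} := by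
  obtain ⟨Q, hf, hL, hc⟩ := (reg_iff L).1 h
  let Φ : Set (σ × Set (List α)) → Set (List β) :=
    fun T => {w | ∃ p ∈ T, ∃ l ∈ p.2, w = mealy st out p.1 l}
  refine (reg_iff _).2 ⟨Φ '' {T | T ⊆ Set.univ ×ˢ Q},
    ((Set.finite_univ.prod hf).finite_subsets).image _, ⟨{(s, L)}, ?_, ?_⟩, ?_⟩
  · rintro _ rfl; exact ⟨trivial, hL⟩
  · ext w; simp [Φ]
  · rintro _ ⟨T, hT, rfl⟩ b
    refine ⟨{p | ∃ p' ∈ T, ∃ a, out p'.1 a = b ∧ p = (st p'.1 a, {x | a :: x ∈ p'.2})}, ?_, ?_⟩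
    · rintro _ ⟨p', hp', a, -, rfl⟩
      exact ⟨trivial, hc _ (hT hp').2 a⟩
    · ext w
      constructor
      · rintro ⟨_, ⟨p', hp', a, hb, rfl⟩, l, hl, rfl⟩
        exact ⟨p', hp', a :: l, hl, by simp [mealy, hb]⟩
      · rintro ⟨p', hp', l, hl, hw⟩
        cases l with
        | nil => simp [mealy] at hw
        | cons a l =>
          simp only [mealy, List.cons.injEq] at hw
          exact ⟨_, ⟨p', hp', a, hw.1.symm, rfl⟩, l, hl, hw.2⟩

/-! ### Synchronous relations -/

/-- Convolution with anonymous padding. -/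
def conv {E : Type} : List E → List E → List (Option E × Option E)
  | [], [] => []
  | a :: as, [] => (some a, none) :: conv as []
  | [], b :: bs => (none, some b) :: conv [] bs
  | a :: as, b :: bs => (some a, some b) :: conv as bs

def convL {E : Type} (R : Set (List E × List E)) : Set (List (Option E × Option E)) :=
  {w | ∃ p ∈ R, w = conv p.1 p.2}

/-- Coinductive consing: `Pre x a b` says the padded stream of `b` is `x` followed by that of `a`. -/
def Pre {E : Type} : Option E → List E → List E → Prop
  | some e, a, b => b = e :: a
  | none, a, b => a = [] ∧ b = []

theorem pre_exists {E : Type} (b : List E) : ∃ x a, Pre x a b := by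
  cases b with
  | nil => exact ⟨none, [], rfl, rfl⟩
  | cons e b => exact ⟨some e, b, rfl⟩

theorem pre_unique {E : Type} {x : Option E} {a b b' : List E} (h : Pre x a b) (h' : Pre x a b') :
    b = b' := by
  cases x <;> simp_all [Pre]

/-- Derivative of a relation. -/
def der {E : Type} (p : Option E × Option E) (R : Set (List E × List E)) :
    Set (List E × List E) :=
  {q | ∃ r ∈ R, Pre p.1 q.1 r.1 ∧ Pre p.2 q.2 r.2}

def RegRel {E : Type} (R : Set (List E × List E)) : Prop :=
  ∃ Q : Set (Set (List E × List E)), Q.Finite ∧ R ∈ Q ∧ ∀ q ∈ Q, ∀ p, der p q ∈ Q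

theorem conv_fst {E : Type} (a b : List E) : (conv a b).filterMap Prod.fst = a := by
  fun_induction conv a b with
  | case1 => rfl
  | case2 a as ih => rw [List.filterMap_cons, ih]
  | case3 b bs ih => rw [List.filterMap_cons, ih]
  | case4 a as b bs ih => rw [List.filterMap_cons, ih]

theorem conv_snd {E : Type} (a b : List E) : (conv a b).filterMap Prod.snd = b := by
  fun_induction conv a b with
  | case1 => rfl
  | case2 a as ih => rw [List.filterMap_cons, ih]
  | case3 b bs ih => rw [List.filterMap_cons, ih]
  | case4 a as b bs ih => rw [List.filterMap_cons, ih]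

theorem conv_inj {E : Type} {a b a' b' : List E} (h : conv a b = conv a' b') : a = a' ∧ b = b' := by
  constructor
  · rw [← conv_fst a b, h, conv_fst]
  · rw [← conv_snd a b, h, conv_snd]

theorem convL_inj {E : Type} : Function.Injective (convL (E := E)) := by
  have : ∀ R R' : Set (List E × List E), convL R = convL R' → R ⊆ R' := by
    rintro R R' h ⟨a, b⟩ hab
    have : conv a b ∈ convL R' := h ▸ ⟨(a, b), hab, rfl⟩
    obtain ⟨⟨a', b'⟩, h', e⟩ := this
    obtain ⟨rfl, rfl⟩ := conv_inj e
    exact h'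
  intro R R' h
  exact Set.Subset.antisymm (this _ _ h) (this _ _ h.symm)

theorem conv_pre {E : Type} {p : Option E × Option E} (hp : p ≠ (none, none)) {a b a' b' : List E}
    (h : Pre p.1 a a') (h' : Pre p.2 b b') : conv a' b' = p :: conv a b := by
  obtain ⟨_ | x, _ | y⟩ := p
  · exact absurd rfl hp
  all_goals simp only [Pre] at h h'
  all_goals obtain ⟨rfl, rfl⟩ := h
  all_goals obtain ⟨rfl, rfl⟩ := h'
  all_goals simp [conv]

theorem conv_cons {E : Type} {p : Option E × Option E} {a' b' : List E}
    {w : List (Option E × Option E)} (h : p :: w = conv a' b') :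
    p ≠ (none, none) ∧ ∃ a b, Pre p.1 a a' ∧ Pre p.2 b b' ∧ w = conv a b := by
  cases a' with
  | nil =>
    cases b' with
    | nil => simp [conv] at h
    | cons y b =>
      simp only [conv, List.cons.injEq] at h
      obtain ⟨rfl, rfl⟩ := h
      exact ⟨by simp, [], b, ⟨rfl, rfl⟩, rfl, rfl⟩
  | cons x a =>
    cases b' with
    | nil =>
      simp only [conv, List.cons.injEq] at h
      obtain ⟨rfl, rfl⟩ := h
      exact ⟨by simp, a, [], rfl, ⟨rfl, rfl⟩, rfl⟩
    | cons y b =>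
      simp only [conv, List.cons.injEq] at h
      obtain ⟨rfl, rfl⟩ := h
      exact ⟨by simp, a, b, rfl, rfl, rfl⟩

theorem convL_der {E : Type} {p : Option E × Option E} (hp : p ≠ (none, none))
    (R : Set (List E × List E)) : convL (der p R) = {x | p :: x ∈ convL R} := by
  ext w
  constructor
  · rintro ⟨⟨a, b⟩, ⟨⟨a', b'⟩, hR, h1, h2⟩, rfl⟩
    exact ⟨(a', b'), hR, (conv_pre hp h1 h2).symm⟩
  · rintro ⟨⟨a', b'⟩, hR, h⟩
    obtain ⟨-, a, b, h1, h2, rfl⟩ := conv_cons h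
    exact ⟨(a, b), ⟨(a', b'), hR, h1, h2⟩, rfl⟩

theorem regRel_iff {E : Type} (R : Set (List E × List E)) : RegRel R ↔ IsRegularSet (convL R) := by
  rw [reg_iff]
  constructor
  · rintro ⟨Q, hf, hR, hc⟩
    refine ⟨insert ∅ (convL '' Q), (hf.image _).insert _, Or.inr ⟨R, hR, rfl⟩, ?_⟩
    rintro q (rfl | ⟨q, hq, rfl⟩) p
    · left; ext; simp
    · by_cases hp : p = (none, none)
      · left
        ext x
        simp only [Set.mem_ofPred_eq, Set.mem_empty_iff_false, iff_false]
        rintro ⟨⟨a, b⟩, -, h⟩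
        exact (conv_cons h).1 hp
      · right
        exact ⟨_, hc q hq p, convL_der hp q⟩
  · rintro ⟨Q, hf, hR, hc⟩
    refine ⟨insert ∅ (insert {([], [])} (convL ⁻¹' Q)),
      (((hf.preimage convL_inj.injOn)).insert _).insert _, Or.inr (Or.inr hR), ?_⟩
    have hnone : ∀ q : Set (List E × List E), der (none, none) q = ∅ ∨
        der (none, none) q = {([], [])} := by
      intro q
      by_cases h : (([] : List E), ([] : List E)) ∈ q
      · right
        ext ⟨a, b⟩
        constructor
        · rintro ⟨r, hr, ⟨h1, _⟩, ⟨h2, _⟩⟩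
          simp only at h1 h2
          simp [h1, h2]
        · intro hh
          simp only [Set.mem_singleton_iff, Prod.mk.injEq] at hh
          exact ⟨_, h, ⟨hh.1, rfl⟩, ⟨hh.2, rfl⟩⟩
      · left
        ext ⟨a, b⟩
        simp only [Set.mem_empty_iff_false, iff_false]
        rintro ⟨⟨r1, r2⟩, hr, ⟨_, h1⟩, ⟨_, h2⟩⟩
        simp only at h1 h2
        subst h1 h2
        exact h hr
    rintro q hq p
    by_cases hp : p = (none, none)
    · subst hp
      rcases hnone q with h | h
      · exact Or.inl h
      · exact Or.inr (Or.inl h)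
    · rcases hq with rfl | rfl | hq
      · left; ext; simp [der]
      · left
        ext ⟨a, b⟩
        simp only [Set.mem_empty_iff_false, iff_false]
        rintro ⟨r, hr, h1, h2⟩
        obtain rfl := hr
        obtain ⟨_ | x, _ | y⟩ := p <;> simp_all [Pre]
      · right; right
        show convL _ ∈ Q
        rw [convL_der hp]
        exact hc _ hq p

theorem regRel_comp {E : Type} {R R' : Set (List E × List E)} (h : RegRel R) (h' : RegRel R') :
    RegRel {p | ∃ b, (p.1, b) ∈ R ∧ (b, p.2) ∈ R'} := by
  obtain ⟨Q, hf, hR, hc⟩ := h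
  obtain ⟨Q', hf', hR', hc'⟩ := h'
  let Φ : Set (Set (List E × List E) × Set (List E × List E)) → Set (List E × List E) :=
    fun T => {p | ∃ t ∈ T, ∃ b, (p.1, b) ∈ t.1 ∧ (b, p.2) ∈ t.2}
  refine ⟨Φ '' {T | T ⊆ Q ×ˢ Q'}, ((hf.prod hf').finite_subsets).image _, ⟨{(R, R')}, ?_, ?_⟩, ?_⟩
  · rintro _ rfl; exact ⟨hR, hR'⟩
  · ext p; simp [Φ]
  · rintro _ ⟨T, hT, rfl⟩ ⟨x, z⟩
    refine ⟨{t | ∃ t' ∈ T, ∃ y, t = (der (x, y) t'.1, der (y, z) t'.2)}, ?_, ?_⟩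
    · rintro _ ⟨t', ht', y, rfl⟩
      exact ⟨hc _ (hT ht').1 _, hc' _ (hT ht').2 _⟩
    · ext ⟨a, c⟩
      constructor
      · rintro ⟨_, ⟨t', ht', y, rfl⟩, b, ⟨⟨a1, b1⟩, h1, h2, h3⟩, ⟨⟨b2, c2⟩, h4, h5, h6⟩⟩
        have : b1 = b2 := pre_unique h3 h5
        subst this
        exact ⟨(a1, c2), ⟨t', ht', b1, h1, h4⟩, h2, h6⟩
      · rintro ⟨⟨a1, c1⟩, ⟨t', ht', b1, h1, h2⟩, h3, h4⟩
        obtain ⟨y, b, hb⟩ := pre_exists b1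
        exact ⟨_, ⟨t', ht', y, rfl⟩, b, ⟨_, h1, h3, hb⟩, ⟨_, h2, hb, h4⟩⟩

theorem regRel_restrict {E : Type} {R : Set (List E × List E)} (h : RegRel R) {D : Set (List E)}
    (hD : IsRegularSet D) : RegRel {p | p ∈ R ∧ p.1 ∈ D} := by
  rw [regRel_iff] at h ⊢
  have := reg_inter h (reg_comap hD (Prod.fst : Option E × Option E → Option E))
  convert this using 1
  ext w
  constructor
  · rintro ⟨⟨a, b⟩, ⟨h1, h2⟩, rfl⟩
    exact ⟨⟨_, h1, rfl⟩, by simpa [conv_fst] using h2⟩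
  · rintro ⟨⟨⟨a, b⟩, h1, rfl⟩, h2⟩
    exact ⟨_, ⟨h1, by simpa [conv_fst] using h2⟩, rfl⟩

/-- recursive form of the padded pair. -/
def dp {V E : Type} (etgt : E → V) : Option E → Option E → List E → List E →
    List ((E ⊕ Option V) × (E ⊕ Option V))
  | _, _, [], [] => []
  | _, t, a :: as, [] => (Sum.inl a, Sum.inr (t.map etgt)) :: dp etgt (some a) t as []
  | s, _, [], b :: bs => (Sum.inr (s.map etgt), Sum.inl b) :: dp etgt s (some b) [] bs
  | _, _, a :: as, b :: bs => (Sum.inl a, Sum.inl b) :: dp etgt (some a) (some b) as bs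

theorem getLast?_cons_or {E : Type} (a : E) (l : List E) (s : Option E) :
    (a :: l).getLast?.or s = l.getLast?.or (some a) := by
  cases l with
  | nil => simp
  | cons b l => simp [List.getLast?_cons]

theorem dp_eq {V E : Type} (etgt : E → V) (s t : Option E) (a b : List E) :
    dp etgt s t a b = (a.map Sum.inl).zip (b.map Sum.inl) ++
    (if a.length ≤ b.length
      then (b.drop a.length).map (fun e => (Sum.inr ((a.getLast?.or s).map etgt), Sum.inl e))
      else (a.drop b.length).map (fun e => (Sum.inl e, Sum.inr ((b.getLast?.or t).map etgt)))) := by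
  fun_induction dp etgt s t a b with
  | case1 => simp
  | case2 s t a as ih => rw [ih]; cases as <;> simp
  | case3 s t b bs ih => rw [ih]; simp
  | case4 s t a as b bs ih => rw [ih]; simp [getLast?_cons_or]

theorem deltaPair_eq {V E : Type} (etgt : E → V) (a b : List E) :
    deltaPair etgt a b = dp etgt none none a b := by
  rw [dp_eq]; simp [deltaPair, padSym]

theorem regRel_of_sync {V E : Type} (etgt : E → V) {R : Set (List E × List E)}
    (h : SyncRegular etgt R) : RegRel R := by
  rw [regRel_iff]
  let f : (E ⊕ Option V) × (E ⊕ Option V) → Option E × Option E :=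
    fun p => (p.1.getLeft?, p.2.getLeft?)
  have hf : ∀ s t a b, mealy (fun (_ : Unit) _ => ()) (fun _ x => f x) () (dp etgt s t a b)
      = conv a b := by
    intro s t a b
    fun_induction dp etgt s t a b <;> simp_all [mealy, conv, f]
  have := reg_mealy (fun (_ : Unit) _ => ()) (fun _ x => f x) () h
  convert this using 1
  ext w
  constructor
  · rintro ⟨p, hp, rfl⟩
    exact ⟨_, ⟨p, hp, rfl⟩, by rw [deltaPair_eq, hf]⟩
  · rintro ⟨_, ⟨p, hp, rfl⟩, rfl⟩
    exact ⟨p, hp, by rw [deltaPair_eq, hf]⟩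

/-- Encoding of a word by edges remembering the previous letter. -/
def enc {X : Type} : Option X → List X → List (Option X × X)
  | _, [] => []
  | p, x :: l => (p, x) :: enc (some x) l

theorem enc_snoc {X : Type} (p : Option X) (l : List X) (x : X) :
    enc p (l ++ [x]) = enc p l ++ [(l.getLast?.or p, x)] := by
  induction l generalizing p with
  | nil => simp [enc]
  | cons a l ih => simp [enc, ih, ← getLast?_cons_or a l p]

theorem reg_enc {X : Type} [Finite X] {L : Set (List X)} (h : IsRegularSet L) :
    IsRegularSet {w | ∃ l ∈ L, w = enc none l} := by
  have hm : ∀ p (l : List X), mealy (fun _ x => some x) (fun p x => (p, x)) p l = enc p l := by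
    intro p l
    fun_induction enc p l <;> simp_all [mealy]
  have := reg_mealy (fun (_ : Option X) x => some x) (fun p x => (p, x)) none h
  simpa only [hm] using this

theorem sync_enc {X V : Type} [Finite X] (etgt : Option X × X → V) {R : Set (List X × List X)}
    (h : RegRel R) :
    SyncRegular etgt {p | ∃ r ∈ R, p = (enc none r.1, enc none r.2)} := by
  rw [regRel_iff] at h
  let σ := Option (Option X × X)
  let st1 : σ → Option X → σ := fun s x => match x with
    | some x => some (s.map Prod.snd, x)
    | none => s
  let out1 : σ → Option X → (Option X × X) ⊕ Option V := fun s x => match x with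
    | some x => Sum.inl (s.map Prod.snd, x)
    | none => Sum.inr (s.map etgt)
  let st : σ × σ → Option X × Option X → σ × σ := fun s x => (st1 s.1 x.1, st1 s.2 x.2)
  let out : σ × σ → Option X × Option X → _ := fun s x => (out1 s.1 x.1, out1 s.2 x.2)
  have hm : ∀ (a b : List X) (s t : σ), mealy st out (s, t) (conv a b)
      = dp etgt s t (enc (s.map Prod.snd) a) (enc (t.map Prod.snd) b) := by
    intro a b
    fun_induction conv a b with
    | case1 => intro s t; simp [mealy, enc, dp]
    | case2 a as ih => intro s t; simp only [mealy, enc, dp, st, out, st1, out1]; congr 1; exact ih _ _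
    | case3 a as ih => intro s t; simp only [mealy, enc, dp, st, out, st1, out1]; congr 1; exact ih _ _
    | case4 a as b bs ih => intro s t; simp only [mealy, enc, dp, st, out, st1, out1]; congr 1; exact ih _ _
  have := reg_mealy st out (none, none) h
  unfold SyncRegular
  convert this using 1
  ext w
  constructor
  · rintro ⟨_, ⟨r, hr, rfl⟩, rfl⟩
    exact ⟨_, ⟨r, hr, rfl⟩, by rw [deltaPair_eq, hm]; rfl⟩
  · rintro ⟨_, ⟨r, hr, rfl⟩, rfl⟩
    exact ⟨_, ⟨r, hr, rfl⟩, by rw [deltaPair_eq, hm]; rfl⟩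


/-! ### Evaluation of words -/

theorem evalPath_append {O A E : Type} (S : PreSgpd O A) (lab : E → A) {u : List E} {a : A}
    (h : evalPath? S lab u = some a) (l : List E) :
    evalPath? S lab (u ++ l) = some ((l.map lab).foldl S.mul a) := by
  cases u with
  | nil => simp [evalPath?] at h
  | cons e u =>
    simp only [evalPath?, Option.some.injEq] at h
    simp [evalPath?, ← h]

theorem evalPath_isSome {O A E : Type} (S : PreSgpd O A) (lab : E → A) {u : List E}
    (h : u ≠ []) : ∃ a, evalPath? S lab u = some a := by
  cases u with
  | nil => exact absurd rfl h
  | cons e u => exact ⟨_, rfl⟩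

theorem foldl_mul {A : Type} (mul : A → A → A) (assoc : ∀ a b c, mul (mul a b) c = mul a (mul b c))
    (l : List A) (a b : A) : l.foldl mul (mul a b) = mul a (l.foldl mul b) := by
  induction l generalizing b with
  | nil => rfl
  | cons c l ih => rw [List.foldl_cons, assoc, ih]; rfl

theorem evalPath_mul {O A E : Type} (S : PreSgpd O A) (lab : E → A)
    (assoc : ∀ a b c, S.mul (S.mul a b) c = S.mul a (S.mul b c)) {w : List E} {m : A}
    (h : evalPath? S lab w = some m) (a : A) : (w.map lab).foldl S.mul a = S.mul a m := by
  cases w with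
  | nil => simp [evalPath?] at h
  | cons e u =>
    simp only [evalPath?, Option.some.injEq] at h
    rw [List.map_cons, List.foldl_cons, foldl_mul _ assoc, h]

/-- The relation of right multiplication by a word. -/
def relW {A E : Type} {S : PreSgpd Unit A} (C : ChoiceOfReps S E) (w : List E) :
    Set (List E × List E) :=
  {p | p.1 ∈ C.K ∧ p.2 ∈ C.K ∧ ∃ a, evalPath? S C.lab p.1 = some a ∧
    evalPath? S C.lab p.2 = some ((w.map C.lab).foldl S.mul a)}

theorem pathTgt_unit {E : Type} (etgt : E → Unit) {u : List E} (h : u ≠ []) :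
    pathTgt? etgt u = some () := by
  unfold pathTgt?
  rw [List.getLast?_eq_some_getLast h]; rfl

theorem relW_reg {A E : Type} {S : PreSgpd Unit A} (C : ChoiceOfReps S E)
    (h : IsAutomaticStructure C) (w : List E) : RegRel (relW C w) := by
  obtain ⟨hE, hK, hedge, hvert⟩ := h
  induction w with
  | nil =>
    convert regRel_of_sync _ (hvert ()) using 1
    ext ⟨u, v⟩
    constructor
    · rintro ⟨hu, hv, a, h1, h2⟩
      exact ⟨hu, hv, pathTgt_unit _ (C.K_path _ hu).1, h1.trans h2.symm⟩
    · rintro ⟨hu, hv, -, h1⟩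
      obtain ⟨a, ha⟩ := evalPath_isSome S C.lab (C.K_path _ hu).1
      exact ⟨hu, hv, a, ha, h1.symm.trans ha⟩
  | cons x l ih =>
    convert regRel_comp (regRel_of_sync _ (hedge x)) ih using 1
    ext ⟨u, v⟩
    constructor
    · rintro ⟨hu, hv, a, h1, h2⟩
      obtain ⟨b, hb, hb'⟩ := C.K_onto (S.mul a (C.lab x))
      refine ⟨b, ⟨hu, hb, pathTgt_unit _ (C.K_path _ hu).1, ?_⟩, hb, hv, _, hb', h2⟩
      rw [evalPath_append S C.lab h1]
      exact hb'.symm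
    · rintro ⟨b, ⟨hu, hb, -, h1⟩, -, hv, a', h2, h3⟩
      obtain ⟨a, ha⟩ := evalPath_isSome S C.lab (C.K_path _ hu).1
      rw [evalPath_append S C.lab ha] at h1
      simp only at h1 h2
      rw [h2] at h1
      refine ⟨hu, hv, a, ha, ?_⟩
      rw [h3, List.map_cons, List.foldl_cons]
      simp only [List.map_cons, List.map_nil, List.foldl_cons, List.foldl_nil,
        Option.some.injEq] at h1
      rw [h1]

/-! ### Rees matrix semigroups -/

section ReesPart

open Rees

variable {O A I Λ X : Type}

/-- Underlying triple. -/
def val (S : Sgpd O A) (R : Data0 S I Λ) (c : Carrier0 S R) : Option (I × A × Λ) :=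
  Option.map Subtype.val c

theorem val_inj (S : Sgpd O A) (R : Data0 S I Λ) : Function.Injective (val S R) :=
  Option.map_injective Subtype.val_injective

theorem val_valid (S : Sgpd O A) (R : Data0 S I Λ) {c : Carrier0 S R} {t : I × A × Λ}
    (h : val S R c = some t) : Valid S R.F R.G t := by
  rcases c with _ | a
  · exact absurd h (by rintro ⟨⟩)
  · obtain rfl : a.1 = t := Option.some.inj h
    exact a.2

/-- Multiplication of triples, without proofs. -/
def vmul (S : Sgpd O A) (R : Data0 S I Λ) (a b : Option (I × A × Λ)) : Option (I × A × Λ) :=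
  a.bind fun s => b.bind fun t => (R.P s.2.2 t.1).map fun p =>
    (s.1, S.mul (S.mul s.2.1 p) t.2.1, t.2.2)

theorem val_mul (S : Sgpd O A) (R : Data0 S I Λ) (a b : Carrier0 S R) :
    val S R (mul0 S R a b) = vmul S R (val S R a) (val S R b) := by
  rcases a with _ | ⟨⟨i, x, l⟩, ha⟩
  · rfl
  rcases b with _ | ⟨⟨j, y, m⟩, hb⟩
  · rfl
  unfold mul0
  split
  · rename_i heq heq'
    cases heq; cases heq'
    split
    · rename_i p hp
      show some (i, S.mul (S.mul x p) y, m) =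
        (R.P l j).map fun p => (i, S.mul (S.mul x p) y, m)
      rw [hp]; rfl
    · rename_i hp
      show _ = (R.P l j).map _
      rw [hp]; rfl
  · simp_all
  · simp_all

theorem vmul_some (S : Sgpd O A) (R : Data0 S I Λ) {a b : Option (I × A × Λ)} {i : I} {s : A} {m : Λ}
    (h : vmul S R a b = some (i, s, m)) : ∃ x l j y p, a = some (i, x, l) ∧ b = some (j, y, m) ∧
      R.P l j = some p ∧ s = S.mul (S.mul x p) y := by
  rcases a with _ | ⟨i', x, l⟩
  · simp [vmul] at h
  rcases b with _ | ⟨j, y, m'⟩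
  · simp [vmul] at h
  simp only [vmul, Option.bind_some, Option.map_eq_some_iff, Prod.mk.injEq] at h
  obtain ⟨p, hp, rfl, rfl, rfl⟩ := h
  exact ⟨x, l, j, y, p, rfl, rfl, hp, rfl⟩

theorem mul0_assoc (S : Sgpd O A) (R : Data0 S I Λ) (a b c : Carrier0 S R) :
    mul0 S R (mul0 S R a b) c = mul0 S R a (mul0 S R b c) := by
  apply val_inj
  simp only [val_mul]
  rcases ha : val S R a with _ | ⟨i, x, l⟩
  · rfl
  rcases hb : val S R b with _ | ⟨j, y, m⟩
  · rfl
  rcases hc : val S R c with _ | ⟨k, z, n⟩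
  · simp [vmul]
  have ha := val_valid S R ha
  have hb := val_valid S R hb
  have hc := val_valid S R hc
  rcases hp : R.P l j with _ | p
  · rcases hq : R.P m k with _ | q <;> simp [vmul, hp, hq]
  rcases hq : R.P m k with _ | q
  · simp [vmul, hp, hq]
  have p1 := R.P_src _ _ _ hp
  have p2 := R.P_tgt _ _ _ hp
  have q1 := R.P_src _ _ _ hq
  have q2 := R.P_tgt _ _ _ hq
  obtain ⟨-, ha⟩ := ha
  obtain ⟨hb1, hb2⟩ := hb
  obtain ⟨hc1, -⟩ := hc
  simp only at ha hb1 hb2 hc1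
  have e1 : S.tgt x = S.src p := by rw [ha, p1]
  have e2 : S.tgt p = S.src y := by rw [p2, hb1]
  have e3 : S.tgt y = S.src q := by rw [hb2, q1]
  have e4 : S.tgt q = S.src z := by rw [q2, hc1]
  have e5 : S.tgt (S.mul x p) = S.src y := by rw [S.tgt_mul _ _ e1, e2]
  have e6 : S.tgt (S.mul y q) = S.src z := by rw [S.tgt_mul _ _ e3, e4]
  have e7 : S.src (S.mul y q) = S.src y := S.src_mul _ _ e3
  simp only [vmul, hp, hq, Option.bind_some, Option.map_some, Option.some.injEq, Prod.mk.injEq,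
    true_and, and_true]
  rw [S.mul_assoc' (S.mul x p) y q e5 e3, S.mul_assoc' (S.mul x p) (S.mul y q) z (by rw [e5, e7]) e6]

/-- `u` evaluates to the non-zero triple `t`. -/
def Ev (S : Sgpd O A) (R : Data0 S I Λ) (lab : X → Carrier0 S R) (u : List X) (t : I × A × Λ) : Prop :=
  ∃ c, evalPath? (pre0 S R) lab u = some c ∧ val S R c = some t

/-- The row/column type of an element. -/
def ty (S : Sgpd O A) (R : Data0 S I Λ) (c : Carrier0 S R) : Option (I × Λ) :=
  (val S R c).map fun t => (t.1, t.2.2)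

theorem ty_mul (S : Sgpd O A) (R : Data0 S I Λ) (a b : Carrier0 S R) :
    ty S R (mul0 S R a b) = (ty S R a).bind fun s => (ty S R b).bind fun t =>
      (R.P s.2 t.1).map fun _ => (s.1, t.2) := by
  unfold ty
  rw [val_mul]
  rcases val S R a with _ | ⟨i, x, l⟩
  · rfl
  rcases val S R b with _ | ⟨j, y, m⟩
  · rfl
  rcases hp : R.P l j with _ | p <;> simp [vmul, hp]

/-- The type of a word. -/
def qty (S : Sgpd O A) (R : Data0 S I Λ) (lab : X → Carrier0 S R) (u : List X) :
    Option (Option (I × Λ)) :=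
  (evalPath? (pre0 S R) lab u).map (ty S R)

theorem eval_snoc {O A E : Type} (S : PreSgpd O A) (lab : E → A) {u : List E} {a : A}
    (h : evalPath? S lab u = some a) (x : E) :
    evalPath? S lab (u ++ [x]) = some (S.mul a (lab x)) := by
  rw [evalPath_append S lab h]; rfl

theorem qty_reg (S : Sgpd O A) (R : Data0 S I Λ) (lab : X → Carrier0 S R) [Finite I] [Finite Λ]
    (B : Set (Option (Option (I × Λ)))) : IsRegularSet {u | qty S R lab u ∈ B} := by
  refine reg_invariant (qty S R lab) (fun s x => match s with
    | none => some (ty S R (lab x))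
    | some s => some (s.bind fun s => (ty S R (lab x)).bind fun t =>
      (R.P s.2 t.1).map fun _ => (s.1, t.2))) ?_ B
  intro w x
  by_cases hw : w = []
  · subst hw; rfl
  · obtain ⟨c, hc⟩ := evalPath_isSome (pre0 S R) lab hw
    unfold qty
    rw [eval_snoc _ _ hc, hc]
    exact congrArg some (ty_mul S R c (lab x))

theorem ty_ends (S : Sgpd O A) (R : Data0 S I Λ) (lab : X → Carrier0 S R) (u : List X)
    (c : Carrier0 S R) (hc : evalPath? (pre0 S R) lab u = some c) (i : I) (l : Λ)
    (h : ty S R c = some (i, l)) :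
    (∃ x m, ty S R (lab x) = some (i, m)) ∧ (∃ x j, ty S R (lab x) = some (j, l)) := by
  induction u using List.reverseRecOn generalizing c i l with
  | nil => simp [evalPath?] at hc
  | append_singleton u x ih =>
    by_cases hu : u = []
    · subst hu
      obtain rfl : lab x = c := Option.some.inj hc
      exact ⟨⟨x, l, h⟩, ⟨x, i, h⟩⟩
    · obtain ⟨c', hc'⟩ := evalPath_isSome (pre0 S R) lab hu
      rw [eval_snoc _ _ hc'] at hc
      obtain rfl : mul0 S R c' (lab x) = c := Option.some.inj hc
      rw [ty_mul] at h
      simp only [Option.bind_eq_some_iff, Option.map_eq_some_iff, Prod.mk.injEq] at h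
      obtain ⟨⟨i', l'⟩, h1, ⟨j, m⟩, h2, p, hp, rfl, rfl⟩ := h
      exact ⟨(ih c' hc' _ _ h1).1, ⟨x, j, h2⟩⟩

/-- Any valid triple gives an element. -/
theorem exists_val (S : Sgpd O A) (R : Data0 S I Λ) {t : I × A × Λ} (h : Valid S R.F R.G t) :
    ∃ c : Carrier0 S R, val S R c = some t := ⟨some ⟨t, h⟩, rfl⟩

theorem finite_idx (S : Sgpd O A) (R : Data0 S I Λ) [Finite X] (C : ChoiceOfReps (pre0 S R) X) :
    Finite I ∧ Finite Λ := by
  constructor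
  · have : (Set.univ : Set (Option I)) ⊆
        insert none (Set.range fun x : X => (ty S R (C.lab x)).map Prod.fst) := by
      rintro (_ | i) -
      · exact Or.inl rfl
      right
      obtain ⟨a, ha⟩ := R.F_into i
      obtain ⟨l, hl⟩ := R.G_onto a
      obtain ⟨c, hc⟩ := exists_val S R (t := (i, a, l)) ⟨ha.symm, hl.symm⟩
      obtain ⟨u, -, hu⟩ := C.K_onto c
      obtain ⟨⟨x, m, hx⟩, -⟩ := ty_ends S R C.lab u c hu i l (by simp [ty, hc])
      exact ⟨x, by simp [hx]⟩
    have : Finite (Option I) := Set.finite_univ_iff.1 (((Set.finite_range _).insert _).subset this)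
    exact Finite.of_injective _ (Option.some_injective I)
  · have : (Set.univ : Set (Option Λ)) ⊆
        insert none (Set.range fun x : X => (ty S R (C.lab x)).map Prod.snd) := by
      rintro (_ | l) -
      · exact Or.inl rfl
      right
      obtain ⟨a, ha⟩ := R.G_into l
      obtain ⟨i, hi⟩ := R.F_onto a
      obtain ⟨c, hc⟩ := exists_val S R (t := (i, a, l)) ⟨hi, ha⟩
      obtain ⟨u, -, hu⟩ := C.K_onto c
      obtain ⟨-, ⟨x, m, hx⟩⟩ := ty_ends S R C.lab u c hu i l (by simp [ty, hc])
      exact ⟨x, by simp [hx]⟩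
    have : Finite (Option Λ) := Set.finite_univ_iff.1 (((Set.finite_range _).insert _).subset this)
    exact Finite.of_injective _ (Option.some_injective Λ)

/-- Labels of the new edges. -/
def labS (S : Sgpd O A) (R : Data0 S I Λ) (lab : X → Carrier0 S R) (d : A) : Option X × X → A
  | (none, x) => ((val S R (lab x)).map fun t => t.2.1).getD d
  | (some y, x) => ((val S R (lab y)).bind fun s => (val S R (lab x)).bind fun t =>
      (R.P s.2.2 t.1).map fun p => S.mul p t.2.1).getD d

theorem enc_ev (S : Sgpd O A) (R : Data0 S I Λ) (lab : X → Carrier0 S R) (d : A) (u : List X)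
    (i : I) (s : A) (l : Λ) (h : Ev S R lab u (i, s, l)) :
    evalPath? S.toPreSgpd (labS S R lab d) (enc none u) = some s ∧
    IsPathChain (fun e => S.src (labS S R lab d e)) (fun e => S.tgt (labS S R lab d e)) (enc none u) ∧
    pathTgt? (fun e => S.tgt (labS S R lab d e)) (enc none u) = some (R.G l) ∧
    ∃ y j a, u.getLast? = some y ∧ val S R (lab y) = some (j, a, l) := by
  obtain ⟨c, hc, hv⟩ := h
  induction u using List.reverseRecOn generalizing c i s l with
  | nil => simp [evalPath?] at hc
  | append_singleton u x ih =>
    by_cases hu : u = []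
    · subst hu
      obtain rfl : lab x = c := Option.some.inj hc
      refine ⟨by simp [enc, evalPath?, labS, hv], List.isChain_singleton _, ?_, x, i, s, rfl, hv⟩
      simpa [enc, pathTgt?, labS, hv] using (val_valid S R hv).2
    · obtain ⟨c', hc'⟩ := evalPath_isSome (pre0 S R) lab hu
      rw [eval_snoc _ _ hc'] at hc
      obtain rfl : mul0 S R c' (lab x) = c := Option.some.inj hc
      rw [val_mul] at hv
      obtain ⟨s', l', j, b, p, h1, h2, hp, rfl⟩ := vmul_some S R hv
      obtain ⟨g1, g2, g3, y, k, a, hy, hya⟩ := ih i s' l' c' hc' h1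
      have p1 := R.P_src _ _ _ hp
      have p2 := R.P_tgt _ _ _ hp
      obtain ⟨-, v1⟩ := val_valid S R h1
      obtain ⟨v2, v3⟩ := val_valid S R h2
      simp only at v1 v2 v3
      have e1 : S.tgt s' = S.src p := by rw [v1, p1]
      have e2 : S.tgt p = S.src b := by rw [p2, v2]
      have hlab : labS S R lab d (some y, x) = S.mul p b := by simp [labS, hya, h2, hp]
      rw [enc_snoc, hy]
      simp only [Option.some_or]
      refine ⟨?_, ?_, ?_, x, j, b, by simp, h2⟩
      · rw [eval_snoc _ _ g1, hlab, S.mul_assoc' _ _ _ e1 e2]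
      · unfold IsPathChain at g2 ⊢
        unfold pathTgt? at g3
        refine List.isChain_append.2 ⟨g2, by simp, ?_⟩
        intro e he f hf
        simp only [List.head?_cons, Option.mem_def, Option.some.injEq] at hf
        subst hf
        rw [Option.mem_def] at he
        rw [he] at g3
        simp only [Option.map_some, Option.some.injEq] at g3
        beta_reduce
        rw [g3, hlab, S.src_mul _ _ e2, p1]
      · simp [pathTgt?, hlab, S.tgt_mul _ _ e2, v3]

/-- types allowed. -/
def tyB (I' : Set I) (Λ' : Set Λ) : Set (Option (Option (I × Λ))) :=
  {t | ∃ i ∈ I', ∃ l ∈ Λ', t = some (some (i, l))}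

theorem qty_iff (S : Sgpd O A) (R : Data0 S I Λ) (lab : X → Carrier0 S R) (I' : Set I) (Λ' : Set Λ)
    (u : List X) : qty S R lab u ∈ tyB I' Λ' ↔ ∃ i ∈ I', ∃ l ∈ Λ', ∃ s, Ev S R lab u (i, s, l) := by
  constructor
  · rintro ⟨i, hi, l, hl, h⟩
    simp only [qty, ty, Option.map_eq_some_iff] at h
    obtain ⟨c, hc, ⟨i', s, l'⟩, h1, h2⟩ := h
    simp only [Prod.mk.injEq] at h2
    obtain ⟨rfl, rfl⟩ := h2
    exact ⟨_, hi, _, hl, s, c, hc, h1⟩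
  · rintro ⟨i, hi, l, hl, s, c, hc, h⟩
    exact ⟨i, hi, l, hl, by simp [qty, hc, ty, h]⟩

end ReesPart

theorem stmt_10 {O A I Λ : Type} (S : Sgpd O A) (hne : Nonempty A)
    (hiso : IsolationFree S.toPreSgpd)
    (R : Rees.Data0 S I Λ)
    (hM : IsAutomatic (Rees.pre0 S R))
    (hrig : Rees.StronglyRIG0 S R { a : A | ¬ IsIdentity S.toPreSgpd a }) :
    IsAutomatic S.toPreSgpd := by
  obtain ⟨X, C, hC⟩ := hM
  have hX : Finite X := hC.1
  obtain ⟨hI, hΛ⟩ := finite_idx S R C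
  obtain ⟨d⟩ := hne
  obtain ⟨Λ', hbij, hgen⟩ := hrig
  obtain ⟨I', hI'inj, hI'surj⟩ : ∃ I' : Set I, Set.InjOn R.F I' ∧ ∀ i, ∃ i' ∈ I', R.F i' = R.F i := by
    obtain ⟨I', -, h⟩ := Set.SurjOn.exists_bijOn_subset (Set.surjOn_image R.F Set.univ)
    exact ⟨I', h.injOn, fun i => h.surjOn ⟨i, trivial, rfl⟩⟩
  -- every arrow has a representative
  have honto : ∀ a : A, ∃ u ∈ C.K, ∃ i ∈ I', ∃ l ∈ Λ', Ev S R C.lab u (i, a, l) := by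
    intro a
    obtain ⟨i0, hi0⟩ := R.F_onto a
    obtain ⟨i, hi, hii⟩ := hI'surj i0
    obtain ⟨l, hl, hla⟩ := hbij.surjOn (show S.tgt a ∈ Rees.tgtSet S from ⟨a, rfl⟩)
    obtain ⟨c, hc⟩ := exists_val S R (t := (i, a, l)) ⟨hii.trans hi0, hla.symm⟩
    obtain ⟨u, hu, huc⟩ := C.K_onto c
    exact ⟨u, hu, i, hi, l, hl, c, huc, hc⟩
  let lb := labS S R C.lab d
  let KS : Set (List (Option X × X)) :=
    {w | ∃ u, u ∈ C.K ∩ {u | qty S R C.lab u ∈ tyB I' Λ'} ∧ w = enc none u}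
  have hKS : ∀ w, w ∈ KS → ∃ u ∈ C.K, w = enc none u ∧ ∃ i ∈ I', ∃ l ∈ Λ', ∃ s,
      Ev S R C.lab u (i, s, l) := by
    rintro w ⟨u, ⟨hu, hq⟩, rfl⟩
    exact ⟨u, hu, rfl, (qty_iff ..).1 hq⟩
  have hKS' : ∀ u ∈ C.K, ∀ i ∈ I', ∀ l ∈ Λ', ∀ s, Ev S R C.lab u (i, s, l) → enc none u ∈ KS := by
    intro u hu i hi l hl s h
    exact ⟨u, ⟨hu, (qty_iff ..).2 ⟨i, hi, l, hl, s, h⟩⟩, rfl⟩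
  let CS : ChoiceOfReps S.toPreSgpd (Option X × X) :=
    { esrc := fun e => S.src (lb e)
      etgt := fun e => S.tgt (lb e)
      lab := lb
      lab_src := fun _ => rfl
      lab_tgt := fun _ => rfl
      K := KS
      K_path := by
        intro w hw
        obtain ⟨u, hu, rfl, i, hi, l, hl, s, hs⟩ := hKS w hw
        obtain ⟨h1, h2, -⟩ := enc_ev S R C.lab d u i s l hs
        refine ⟨?_, h2⟩
        intro h
        rw [h] at h1
        simp [evalPath?] at h1
      K_onto := by
        intro a
        obtain ⟨u, hu, i, hi, l, hl, h⟩ := honto a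
        exact ⟨_, hKS' u hu i hi l hl a h, (enc_ev S R C.lab d u i a l h).1⟩ }
  have hvert : ∀ v : O, SyncRegular CS.etgt (relVertex CS v) := by
    intro v
    have hreg := regRel_restrict (relW_reg C hC [])
      (qty_reg S R C.lab (tyB I' {l | l ∈ Λ' ∧ R.G l = v}))
    convert sync_enc CS.etgt hreg using 1
    ext ⟨w, w'⟩
    constructor
    · rintro ⟨hw, hw', ht, he⟩
      obtain ⟨u, hu, h1, i, hi, l, hl, s, hs⟩ := hKS w hw
      obtain ⟨u', hu', h1', i', hi', l', hl', s', hs'⟩ := hKS w' hw'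
      simp only at ht he
      subst h1 h1'
      obtain ⟨g1, -, g3, -⟩ := enc_ev S R C.lab d u i s l hs
      obtain ⟨g1', -, g3', -⟩ := enc_ev S R C.lab d u' i' s' l' hs'
      have hv : R.G l = v := Option.some.inj (g3.symm.trans ht)
      obtain rfl : s = s' := Option.some.inj (g1.symm.trans (he.trans g1'))
      obtain ⟨c, hc, hcv⟩ := hs
      obtain ⟨c', hc', hcv'⟩ := hs'
      have v1 := val_valid S R hcv
      have v2 := val_valid S R hcv'
      obtain rfl : i = i' := hI'inj hi hi' (v1.1.trans v2.1.symm)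
      obtain rfl : l = l' := hbij.injOn hl hl' (v1.2.symm.trans v2.2)
      obtain rfl : c = c' := val_inj S R (hcv.trans hcv'.symm)
      exact ⟨(u, u'), ⟨⟨hu, hu', c, hc, hc'⟩,
        (qty_iff ..).2 ⟨i, hi, l, ⟨hl, hv⟩, s, c, hc, hcv⟩⟩, rfl⟩
    · rintro ⟨⟨u, u'⟩, ⟨⟨hu, hu', c, hc, hc'⟩, hq⟩, he⟩
      obtain ⟨i, hi, l, ⟨hl, hv⟩, s, c1, hc1, hcv⟩ := (qty_iff ..).1 hq
      simp only [Prod.mk.injEq] at he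
      obtain ⟨rfl, rfl⟩ := he
      obtain rfl : c1 = c := Option.some.inj (hc1.symm.trans hc)
      have hs : Ev S R C.lab u (i, s, l) := ⟨c1, hc, hcv⟩
      have hs' : Ev S R C.lab u' (i, s, l) := ⟨c1, hc', hcv⟩
      obtain ⟨g1, -, g3, -⟩ := enc_ev S R C.lab d u i s l hs
      obtain ⟨g1', -, g3', -⟩ := enc_ev S R C.lab d u' i s l hs'
      exact ⟨hKS' u hu i hi l hl s hs, hKS' u' hu' i hi l hl s hs', hv ▸ g3, g1.trans g1'.symm⟩
  refine ⟨_, CS, inferInstance, reg_enc (reg_inter hC.2.1 (qty_reg ..)), ?_, hvert⟩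
  intro a
  by_cases hid : IsIdentity S.toPreSgpd (lb a)
  · -- identity label: same as the vertex relation
    convert hvert (CS.esrc a) using 1
    ext ⟨w, w'⟩
    have key : w ∈ KS → pathTgt? CS.etgt w = some (CS.esrc a) →
        evalPath? S.toPreSgpd CS.lab (w ++ [a]) = evalPath? S.toPreSgpd CS.lab w := by
      intro hw ht
      obtain ⟨u, hu, rfl, i, hi, l, hl, s, hs⟩ := hKS w hw
      obtain ⟨g1, -, g3, -⟩ := enc_ev S R C.lab d u i s l hs
      obtain ⟨c, hc, hcv⟩ := hs
      have hv : R.G l = S.src (lb a) := Option.some.inj (g3.symm.trans ht)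
      have : S.mul s (lb a) = s := hid.2 s ((val_valid S R hcv).2.trans hv)
      show evalPath? S.toPreSgpd lb _ = evalPath? S.toPreSgpd lb _
      rw [eval_snoc _ _ g1, g1, this]
    constructor
    · rintro ⟨hw, hw', ht, he⟩
      exact ⟨hw, hw', ht, (key hw ht).symm.trans he⟩
    · rintro ⟨hw, hw', ht, he⟩
      exact ⟨hw, hw', ht, (key hw ht).trans he⟩
  · obtain ⟨l0, hl0, j, p, y, hp, hpy, hlba⟩ := hgen (lb a) hid
    have p1 := R.P_src _ _ _ hp
    have p2 := R.P_tgt _ _ _ hp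
    obtain ⟨lt, hlt, hlty⟩ := hbij.surjOn (show S.tgt y ∈ Rees.tgtSet S from ⟨y, rfl⟩)
    have hsrc : S.src (lb a) = R.G l0 := by rw [hlba, S.src_mul _ _ hpy, p1]
    obtain ⟨m, hm⟩ := exists_val S R (t := (j, y, lt)) ⟨p2.symm.trans hpy, hlty.symm⟩
    obtain ⟨z, -, hz⟩ := C.K_onto m
    have hmul : ∀ c, List.foldl (Rees.pre0 S R).mul c (z.map C.lab) = Rees.mul0 S R c m :=
      evalPath_mul (Rees.pre0 S R) C.lab (mul0_assoc S R) hz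
    have hval : ∀ c i s, val S R c = some (i, s, l0) →
        val S R (Rees.mul0 S R c m) = some (i, S.mul s (lb a), lt) := by
      intro c i s hc
      have e1 : S.tgt s = S.src p := (val_valid S R hc).2.trans p1.symm
      rw [val_mul, hc, hm, hlba, ← S.mul_assoc' _ _ _ e1 hpy]
      simp [vmul, hp]
    have hreg := regRel_restrict (relW_reg C hC z) (qty_reg S R C.lab (tyB I' {l0}))
    convert sync_enc CS.etgt hreg using 1
    ext ⟨w, w'⟩
    constructor
    · rintro ⟨hw, hw', ht, he⟩
      obtain ⟨u, hu, h1, i, hi, l, hl, s, hs⟩ := hKS w hw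
      obtain ⟨u', hu', h1', i', hi', l', hl', s', hs'⟩ := hKS w' hw'
      simp only at ht he
      subst h1 h1'
      obtain ⟨g1, -, g3, -⟩ := enc_ev S R C.lab d u i s l hs
      obtain ⟨g1', -, g3', -⟩ := enc_ev S R C.lab d u' i' s' l' hs'
      have hv : R.G l = S.src (lb a) := Option.some.inj (g3.symm.trans ht)
      obtain rfl : l = l0 := hbij.injOn hl hl0 (hv.trans hsrc)
      have he' : S.mul s (lb a) = s' :=
        Option.some.inj ((eval_snoc _ _ g1 a).symm.trans (he.trans g1'))
      obtain ⟨c, hc, hcv⟩ := hs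
      obtain ⟨c', hc', hcv'⟩ := hs'
      have hprod := hval c i s hcv
      rw [he'] at hprod
      have v1 := val_valid S R hprod
      have v2 := val_valid S R hcv'
      obtain rfl : i = i' := hI'inj hi hi' (v1.1.trans v2.1.symm)
      obtain rfl : lt = l' := hbij.injOn hlt hl' (v1.2.symm.trans v2.2)
      have hcc : Rees.mul0 S R c m = c' := val_inj S R (hprod.trans hcv'.symm)
      refine ⟨(u, u'), ⟨⟨hu, hu', c, hc, ?_⟩,
        (qty_iff ..).2 ⟨i, hi, l, rfl, s, c, hc, hcv⟩⟩, rfl⟩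
      rw [hmul, hcc]
      exact hc'
    · rintro ⟨⟨u, u'⟩, ⟨⟨hu, hu', c, hc, hc'⟩, hq⟩, he⟩
      obtain ⟨i, hi, l, hl, s, c1, hc1, hcv⟩ := (qty_iff ..).1 hq
      obtain rfl : l = l0 := hl
      simp only [Prod.mk.injEq] at he
      obtain ⟨rfl, rfl⟩ := he
      obtain rfl : c1 = c := Option.some.inj (hc1.symm.trans hc)
      rw [hmul] at hc'
      have hs : Ev S R C.lab u (i, s, l) := ⟨c1, hc, hcv⟩
      have hs' : Ev S R C.lab u' (i, S.mul s (lb a), lt) := ⟨_, hc', hval _ _ _ hcv⟩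
      obtain ⟨g1, -, g3, -⟩ := enc_ev S R C.lab d u i s l hs
      obtain ⟨g1', -, g3', -⟩ := enc_ev S R C.lab d u' _ _ _ hs'
      refine ⟨hKS' u hu i hi l hl0 s hs, hKS' u' hu' i hi lt hlt _ hs', ?_, ?_⟩
      · exact g3.trans (congrArg some hsrc.symm)
      · exact (eval_snoc _ _ g1 a).trans g1'.symm

end AutoRees
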